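/- The Log-Determinant distance d²(A,B) = log det((A+B)/2) − (1/2) log det(AB) on HPD matrices is invariant to matrix inversion: d²(A⁻¹, B⁻¹) = d²(A, B). -/

import Mathlib

open Matrix Complex ComplexOrder

/-- The squared Log-Determinant distance on HPD matrices. -/
noncomputable def logDetDist2 {M : ℕ} (A B : Matrix (Fin M) (Fin M) ℂ) : ℝ :=
  Real.log ((Matrix.det (((1 : ℂ) / 2) • (A + B))).re) -
    (1 / 2) * Real.log ((Matrix.det (A * B)).re)

/-- The determinant of a complex positive definite matrix is a positive real number. -/
theorem Matrix.PosDef.exists_det_eq_ofReal {n : Type*} [Fintype n] [DecidableEq n]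
    {A : Matrix n n ℂ} (hA : A.PosDef) : ∃ a : ℝ, 0 < a ∧ A.det = (a : ℂ) := by
  obtain ⟨hre, him⟩ := Complex.pos_iff.mp hA.det_pos
  exact ⟨A.det.re, hre, Complex.ext rfl (by simpa using him.symm)⟩

/-- The Log-Determinant distance d²(A,B) = log det((A+B)/2) − (1/2) log det(AB)
on HPD matrices is invariant to matrix inversion: d²(A⁻¹, B⁻¹) = d²(A, B). -/
theorem stmt_14 {M : ℕ} (A B : Matrix (Fin M) (Fin M) ℂ)
    (hA : A.PosDef) (hB : B.PosDef) :
    logDetDist2 A⁻¹ B⁻¹ = logDetDist2 A B := by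
  have hmean : (((1 : ℂ) / 2) • (A + B)).PosDef :=
    (hA.add hB).smul (by simp)
  obtain ⟨a, ha, hdA⟩ := hA.exists_det_eq_ofReal
  obtain ⟨b, hb, hdB⟩ := hB.exists_det_eq_ofReal
  obtain ⟨s, hs, hdS⟩ := hmean.exists_det_eq_ofReal
  have huA : IsUnit A.det := hA.det_pos.ne'.isUnit
  have huB : IsUnit B.det := hB.det_pos.ne'.isUnit
  have hinv : ((1 : ℂ) / 2) • (A⁻¹ + B⁻¹) = A⁻¹ * (((1 : ℂ) / 2) • (A + B)) * B⁻¹ := by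
    rw [Matrix.mul_smul, Matrix.smul_mul, Matrix.mul_add, Matrix.add_mul,
      Matrix.nonsing_inv_mul _ huA, Matrix.one_mul, Matrix.mul_assoc,
      Matrix.mul_nonsing_inv _ huB, Matrix.mul_one, add_comm]
  unfold logDetDist2
  rw [hinv]
  simp only [Matrix.det_mul, Matrix.det_nonsing_inv, Ring.inverse_eq_inv', hdA, hdB, hdS]
  simp only [← Complex.ofReal_inv, ← Complex.ofReal_mul, Complex.ofReal_re]
  rw [Real.log_mul (by positivity) (by positivity), Real.log_mul (by positivity) (by positivity),
    Real.log_mul (by positivity) (by positivity), Real.log_mul ha.ne' hb.ne',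
    Real.log_inv, Real.log_inv]
  ring
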